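/- arXiv:2011.07897 — 5 statements merged into one kernel-verified Lean document; each statement's English description precedes it below -/
import Mathlib

section
/- Let ψ_1,…,ψ_n be unit vectors in a finite-dimensional complex inner product space, let w_1,…,w_n be positive reals summing to 1, and let τ_1,…,τ_n be vectors with ⟨ψ_j, τ_j⟩ = 0 for every j (the directional covariant derivatives D_vψ_j). Let A be the n×n Gram matrix A_{jk} = √(w_j w_k)·⟨ψ_j, ψ_k⟩ and assume A is positive definite. Let Z be the n×n Hermitian matrix Z_{jk} = i·√(w_j w_k)·(⟨ψ_j, τ_k⟩ − ⟨τ_j, ψ_k⟩), and let X be the unique Hermitian matrix satisfying (1/2)(A·X + X·A) = Z. Then trace(X·A·X) = 0 if and only if ⟨ψ_j, τ_k⟩ = ⟨τ_j, ψ_k⟩ for all j ≠ k. (This is the necessary and sufficient condition for immunity of the quantum Fisher information to Rayleigh's curse along the direction v.) -/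
open scoped InnerProductSpace ComplexOrder

/-- Necessary and sufficient condition for immunity of the QFI to Rayleigh's curse along a
direction: the curse `tr(X A X)` vanishes iff `⟪ψ_j, τ_k⟫ = ⟪τ_j, ψ_k⟫` for all `j ≠ k`. -/
theorem stmt0 {V : Type*} [NormedAddCommGroup V] [InnerProductSpace ℂ V]
    [FiniteDimensional ℂ V] {n : ℕ}
    (ψ τ : Fin n → V) (w : Fin n → ℝ)
    (hψ : ∀ j, ‖ψ j‖ = 1) (hw : ∀ j, 0 < w j) (hwsum : ∑ j, w j = 1)
    (hτ : ∀ j, ⟪ψ j, τ j⟫_ℂ = 0)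
    (A Z X : Matrix (Fin n) (Fin n) ℂ)
    (hA : ∀ j k, A j k = (Real.sqrt (w j * w k) : ℂ) * ⟪ψ j, ψ k⟫_ℂ)
    (hApd : A.PosDef)
    (hZ : ∀ j k, Z j k = Complex.I * (Real.sqrt (w j * w k) : ℂ) *
      (⟪ψ j, τ k⟫_ℂ - ⟪τ j, ψ k⟫_ℂ))
    (hXherm : X.IsHermitian)
    (hLyap : (1 / 2 : ℂ) • (A * X + X * A) = Z) :
    (X * A * X).trace = 0 ↔ ∀ j k, j ≠ k → ⟪ψ j, τ k⟫_ℂ = ⟪τ j, ψ k⟫_ℂ := by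
  have key : (X * A * X).trace = 0 ↔ Z = 0 := by
    constructor
    · intro h
      have hps : (X * A * X).PosSemidef := by
        have h1 := hApd.posSemidef.conjTranspose_mul_mul_same X
        rwa [hXherm.eq] at h1
      have h0 : X * A * X = 0 := hps.trace_eq_zero_iff.mp h
      have hX : X = 0 := by
        apply Matrix.ext_of_mulVec_single
        intro j
        rw [Matrix.zero_mulVec]
        by_contra hne
        have hpos := hApd.dotProduct_mulVec_pos hne
        rw [Matrix.star_mulVec, hXherm.eq, ← Matrix.dotProduct_mulVec, Matrix.mulVec_mulVec,
          Matrix.mulVec_mulVec, h0, Matrix.zero_mulVec, dotProduct_zero] at hpos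
        exact lt_irrefl _ hpos
      rw [← hLyap, hX]
      simp
    · intro h
      have h1 : A * X + X * A = 0 := by
        rw [h] at hLyap
        exact (smul_eq_zero.mp hLyap).resolve_left (by norm_num)
      have h2 : (X * (A * X + X * A)).trace = 0 := by rw [h1]; simp
      rw [Matrix.mul_add, Matrix.trace_add, ← Matrix.mul_assoc, Matrix.trace_mul_comm X (X * A)] at h2
      exact add_self_eq_zero.mp h2
  rw [key]
  constructor
  · intro h j k _
    have h1 := hZ j k
    have hs : (Real.sqrt (w j * w k) : ℂ) ≠ 0 := by
      have := Real.sqrt_pos.mpr (mul_pos (hw j) (hw k))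
      exact_mod_cast this.ne'
    rw [h, Matrix.zero_apply] at h1
    exact sub_eq_zero.mp ((mul_eq_zero.mp h1.symm).resolve_left (mul_ne_zero Complex.I_ne_zero hs))
  · intro h
    ext j k
    rw [hZ, Matrix.zero_apply]
    by_cases hjk : j = k
    · subst hjk
      have h3 : ⟪τ j, ψ j⟫_ℂ = 0 := inner_eq_zero_symm.mp (hτ j)
      rw [hτ, h3]; simp
    · rw [h j k hjk]; simp
end

section
/- Let r, z ∈ ℝ³ with |r| < 1. Let σ_1, σ_2, σ_3 denote the 2×2 Pauli matrices, set A = (1/2)(I + r_1σ_1 + r_2σ_2 + r_3σ_3) and Z = z_1σ_1 + z_2σ_2 + z_3σ_3, and let X be the unique 2×2 Hermitian matrix satisfying (1/2)(A·X + X·A) = Z. Then trace(X·A·X) = 4·(z·z) + 4·(r·z)²/(1 − |r|²), where r·z and z·z denote the Euclidean inner product on ℝ³. -/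
open scoped InnerProductSpace

/-- The Pauli matrix `σ₁`. -/
def pauli1 : Matrix (Fin 2) (Fin 2) ℂ := !![0, 1; 1, 0]

/-- The Pauli matrix `σ₂`. -/
def pauli2 : Matrix (Fin 2) (Fin 2) ℂ := !![0, -Complex.I; Complex.I, 0]

/-- The Pauli matrix `σ₃`. -/
def pauli3 : Matrix (Fin 2) (Fin 2) ℂ := !![1, 0; 0, -1]

/-- Bloch-vector formula for the two-source QFI curse:
with `A = (1/2)(I + r·σ)`, `Z = z·σ` and `(1/2)(AX + XA) = Z`,
`tr(X A X) = 4 z·z + 4 (r·z)²/(1 - |r|²)`. -/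
theorem stmt9 (r z : EuclideanSpace ℝ (Fin 3)) (hr : ‖r‖ < 1)
    (A Z X : Matrix (Fin 2) (Fin 2) ℂ)
    (hA : A = (1 / 2 : ℂ) •
      (1 + (r 0 : ℂ) • pauli1 + (r 1 : ℂ) • pauli2 + (r 2 : ℂ) • pauli3))
    (hZ : Z = (z 0 : ℂ) • pauli1 + (z 1 : ℂ) • pauli2 + (z 2 : ℂ) • pauli3)
    (hXherm : X.IsHermitian)
    (hLyap : (1 / 2 : ℂ) • (A * X + X * A) = Z) :
    (X * A * X).trace =
      ((4 * ⟪z, z⟫_ℝ + 4 * ⟪r, z⟫_ℝ ^ 2 / (1 - ‖r‖ ^ 2) : ℝ) : ℂ) := by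
  have hn : ‖r‖ ^ 2 = r 0 ^ 2 + r 1 ^ 2 + r 2 ^ 2 := by
    rw [EuclideanSpace.norm_sq_eq]; simp [Fin.sum_univ_three]
  have hzz : ⟪z, z⟫_ℝ = z 0 * z 0 + z 1 * z 1 + z 2 * z 2 := by
    simp only [PiLp.inner_apply, Fin.sum_univ_three, RCLike.inner_apply, conj_trivial]
  have hrz : ⟪r, z⟫_ℝ = r 0 * z 0 + r 1 * z 1 + r 2 * z 2 := by
    simp only [PiLp.inner_apply, Fin.sum_univ_three, RCLike.inner_apply, conj_trivial]
    ring
  have hpos : (1 - (r 0 ^ 2 + r 1 ^ 2 + r 2 ^ 2) : ℝ) ≠ 0 := by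
    rw [← hn]; nlinarith [norm_nonneg r]
  have hposC : (1 - ((r 0 : ℂ) ^ 2 + (r 1 : ℂ) ^ 2 + (r 2 : ℂ) ^ 2)) ≠ 0 := by
    exact_mod_cast hpos
  have htr : (X * A * X).trace = (X * Z).trace := by
    rw [← hLyap, Matrix.mul_smul, Matrix.trace_smul, mul_add, Matrix.trace_add,
      ← mul_assoc, Matrix.trace_mul_comm X (X * A), smul_eq_mul]
    ring
  obtain ⟨x0, x1, x2, x3, hX⟩ : ∃ x0 x1 x2 x3 : ℂ,
      X = !![x0 + x3, x1 - Complex.I * x2; x1 + Complex.I * x2, x0 - x3] := by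
    refine ⟨(X 0 0 + X 1 1) / 2, (X 0 1 + X 1 0) / 2, Complex.I * (X 0 1 - X 1 0) / 2,
      (X 0 0 - X 1 1) / 2, ?_⟩
    have hI := Complex.I_mul_I
    ext i j
    fin_cases i <;> fin_cases j <;> simp
    · ring
    · linear_combination (X 0 1 - X 1 0) / 2 * hI
    · linear_combination -(X 0 1 - X 1 0) / 2 * hI
    · ring
  rw [htr, hn, hzz, hrz]
  clear htr hn hzz hrz hXherm
  push_cast
  generalize (r 0 : ℂ) = a at *
  generalize (r 1 : ℂ) = b at *
  generalize (r 2 : ℂ) = c at *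
  generalize (z 0 : ℂ) = u at *
  generalize (z 1 : ℂ) = v at *
  generalize (z 2 : ℂ) = w at *
  have hI := Complex.I_mul_I
  have e00 := congrFun (congrFun hLyap 0) 0
  have e01 := congrFun (congrFun hLyap 0) 1
  have e10 := congrFun (congrFun hLyap 1) 0
  have e11 := congrFun (congrFun hLyap 1) 1
  subst hA hZ hX
  simp [pauli1, pauli2, pauli3, Matrix.mul_apply, Fin.sum_univ_two, Matrix.one_apply, Matrix.vecMul, dotProduct]
    at e00 e01 e10 e11
  simp [pauli1, pauli2, pauli3, Matrix.mul_apply, Fin.sum_univ_two, Matrix.trace_fin_two]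
  have h0 : x0 + a * x1 + b * x2 + c * x3 = 0 := by
    linear_combination e00 + e11 + b * x2 * hI
  have h3 : x3 + x0 * c = 2 * w := by
    linear_combination e00 - e11
  have h1 : x1 + x0 * a = 2 * u := by
    linear_combination e01 + e10
  have h2 : x2 + x0 * b = 2 * v := by
    linear_combination Complex.I * (e01 - e10) + (x2 + x0 * b - 2 * v) * hI
  have hx : x0 = -2 * (a * u + b * v + c * w) / (1 - (a ^ 2 + b ^ 2 + c ^ 2)) := by
    rw [eq_div_iff hposC]
    linear_combination h0 - a * h1 - b * h2 - c * h3
  have key : 4 * (a * u + b * v + c * w) ^ 2 / (1 - (a ^ 2 + b ^ 2 + c ^ 2))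
      = -2 * x0 * (a * u + b * v + c * w) := by
    rw [hx]; ring
  rw [key]
  linear_combination 2 * u * h1 + 2 * v * h2 + 2 * w * h3 - 2 * x2 * v * hI
end

section
/- Let ψ_1,…,ψ_n be an orthonormal family in a complex inner product space, let w_1,…,w_n be nonnegative reals, and let τ_1,…,τ_n be vectors satisfying ⟨ψ_j, τ_k⟩ = 0 for all j, k (the local orthogonalization condition). Define ρ = Σ_j w_j·|ψ_j⟩⟨ψ_j|, ∂ρ = Σ_j w_j·(|τ_j⟩⟨ψ_j| + |ψ_j⟩⟨τ_j|), and L = 2·Σ_j (|τ_j⟩⟨ψ_j| + |ψ_j⟩⟨τ_j|), where |u⟩⟨v| is the rank-one operator w ↦ ⟨v, w⟩·u. Then (1/2)(L∘ρ + ρ∘L) = ∂ρ, i.e., L is a symmetric logarithmic derivative operator for ρ. -/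
open scoped InnerProductSpace

/-- The rank-one operator `|u⟩⟨v| : w ↦ ⟪v, w⟫ • u`. -/
noncomputable def ketbra {V : Type*} [NormedAddCommGroup V] [InnerProductSpace ℂ V]
    (u v : V) : V →ₗ[ℂ] V where
  toFun w := ⟪v, w⟫_ℂ • u
  map_add' x y := by simp [inner_add_right, add_smul]
  map_smul' c x := by simp [inner_smul_right, smul_smul]

/-- Under the local orthogonalization condition, `L = 2 Σ_j (|τ_j⟩⟨ψ_j| + |ψ_j⟩⟨τ_j|)`
is a symmetric logarithmic derivative for `ρ = Σ_j w_j |ψ_j⟩⟨ψ_j|`: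
`(1/2)(Lρ + ρL) = ∂ρ`. -/
theorem stmt14 {V : Type*} [NormedAddCommGroup V] [InnerProductSpace ℂ V] {n : ℕ}
    (ψ τ : Fin n → V) (hon : Orthonormal ℂ ψ)
    (w : Fin n → ℝ) (hw : ∀ j, 0 ≤ w j)
    (horth : ∀ j k, ⟪ψ j, τ k⟫_ℂ = 0)
    (ρ dρ L : V →ₗ[ℂ] V)
    (hρ : ρ = ∑ j, (w j : ℂ) • ketbra (ψ j) (ψ j))
    (hdρ : dρ = ∑ j, (w j : ℂ) • (ketbra (τ j) (ψ j) + ketbra (ψ j) (τ j)))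
    (hL : L = (2 : ℂ) • ∑ j, (ketbra (τ j) (ψ j) + ketbra (ψ j) (τ j))) :
    (1 / 2 : ℂ) • (L ∘ₗ ρ + ρ ∘ₗ L) = dρ := by
  have horth' : ∀ j k, ⟪τ j, ψ k⟫_ℂ = 0 := fun j k => by
    rw [← inner_conj_symm, horth k j, map_zero]
  have kb : ∀ u v x : V, ketbra u v x = ⟪v, x⟫_ℂ • u := fun _ _ _ => rfl
  have hψ : ∀ j k, ⟪ψ j, ψ k⟫_ℂ = if j = k then 1 else 0 :=
    orthonormal_iff_ite.mp hon
  ext x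
  have hρx : ∀ y, ρ y = ∑ j, ((w j : ℂ) * ⟪ψ j, y⟫_ℂ) • ψ j := fun y => by
    simp only [hρ, kb, LinearMap.sum_apply, LinearMap.smul_apply, smul_smul]
  have hLx : ∀ y, L y = (2 : ℂ) • ∑ j, (⟪ψ j, y⟫_ℂ • τ j + ⟪τ j, y⟫_ℂ • ψ j) := fun y => by
    simp [hL, kb, LinearMap.sum_apply]
  have h1 : ∀ j, ⟪ψ j, ρ x⟫_ℂ = (w j : ℂ) * ⟪ψ j, x⟫_ℂ := fun j => by
    simp [hρx, inner_sum, inner_smul_right, hψ]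
  have h2 : ∀ j, ⟪τ j, ρ x⟫_ℂ = 0 := fun j => by
    simp [hρx, inner_sum, inner_smul_right, horth']
  have h3 : ∀ j, ⟪ψ j, L x⟫_ℂ = 2 * ⟪τ j, x⟫_ℂ := fun j => by
    simp [hLx, inner_sum, inner_add_right, inner_smul_right, hψ, horth]
  have hd : dρ x = ∑ j, (w j : ℂ) • (⟪ψ j, x⟫_ℂ • τ j + ⟪τ j, x⟫_ℂ • ψ j) := by
    simp [hdρ, kb, LinearMap.sum_apply]
  rw [LinearMap.smul_apply, LinearMap.add_apply, LinearMap.comp_apply, LinearMap.comp_apply,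
    hLx (ρ x), hρx (L x), hd]
  simp only [h1, h2, h3]
  rw [Finset.smul_sum, ← Finset.sum_add_distrib, Finset.smul_sum]
  refine Finset.sum_congr rfl fun j _ => ?_
  module
end

section
/- Let ψ_1,…,ψ_n be an orthonormal family in a finite-dimensional complex inner product space, let w_1,…,w_n be nonnegative reals, and let τ_1,…,τ_n and σ_1,…,σ_n be families of vectors with ⟨ψ_j, τ_k⟩ = 0 and ⟨ψ_j, σ_k⟩ = 0 for all j, k. Define ρ = Σ_j w_j·|ψ_j⟩⟨ψ_j|, L_μ = 2·Σ_j (|τ_j⟩⟨ψ_j| + |ψ_j⟩⟨τ_j|), and L_ν = 2·Σ_j (|σ_j⟩⟨ψ_j| + |ψ_j⟩⟨σ_j|). Then Re trace(L_μ∘L_ν∘ρ) = 4·Σ_j w_j·Re⟨τ_j, σ_j⟩. -/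
open scoped InnerProductSpace

theorem ketbra_app {V : Type*} [NormedAddCommGroup V] [InnerProductSpace ℂ V]
    (u v x : V) : ketbra u v x = ⟪v, x⟫_ℂ • u := rfl

theorem trace_ketbra {V : Type*} [NormedAddCommGroup V] [InnerProductSpace ℂ V]
    [FiniteDimensional ℂ V] (u v : V) : LinearMap.trace ℂ V (ketbra u v) = ⟪v, u⟫_ℂ :=
  InnerProductSpace.trace_rankOne u v

theorem comp_ketbra {V : Type*} [NormedAddCommGroup V] [InnerProductSpace ℂ V]
    (A : V →ₗ[ℂ] V) (u v : V) : A ∘ₗ ketbra u v = ketbra (A u) v := by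
  ext x
  simp [ketbra_app]

/-- Under the local orthogonalization condition, the QFI matrix entry is the weighted
average of the pure-state values: `Re tr(L_μ L_ν ρ) = 4 Σ_j w_j Re ⟪τ_j, σ_j⟫`. -/
theorem stmt15 {V : Type*} [NormedAddCommGroup V] [InnerProductSpace ℂ V]
    [FiniteDimensional ℂ V] {n : ℕ}
    (ψ τ σ : Fin n → V) (hon : Orthonormal ℂ ψ)
    (w : Fin n → ℝ) (hw : ∀ j, 0 ≤ w j)
    (hτ : ∀ j k, ⟪ψ j, τ k⟫_ℂ = 0) (hσ : ∀ j k, ⟪ψ j, σ k⟫_ℂ = 0)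
    (ρ Lμ Lν : V →ₗ[ℂ] V)
    (hρ : ρ = ∑ j, (w j : ℂ) • ketbra (ψ j) (ψ j))
    (hLμ : Lμ = (2 : ℂ) • ∑ j, (ketbra (τ j) (ψ j) + ketbra (ψ j) (τ j)))
    (hLν : Lν = (2 : ℂ) • ∑ j, (ketbra (σ j) (ψ j) + ketbra (ψ j) (σ j))) :
    (LinearMap.trace ℂ V (Lμ ∘ₗ Lν ∘ₗ ρ)).re = 4 * ∑ j, w j * (⟪τ j, σ j⟫_ℂ).re := by
  have hs : ∀ j k, ⟪σ k, ψ j⟫_ℂ = 0 := fun j k => inner_eq_zero_symm.1 (hσ j k)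
  have hon' := orthonormal_iff_ite.1 hon
  have h1 : ∀ j, Lν (ψ j) = (2 : ℂ) • σ j := by
    intro j
    simp [hLν, ketbra_app, hs, hon', LinearMap.sum_apply]
  have h2 : ∀ j, Lμ (σ j) = (2 : ℂ) • ∑ k, ⟪τ k, σ j⟫_ℂ • ψ k := by
    intro j
    simp [hLμ, ketbra_app, hσ, LinearMap.sum_apply]
  have h3 : LinearMap.trace ℂ V (Lμ ∘ₗ Lν ∘ₗ ρ) = ∑ j, (w j : ℂ) * (4 * ⟪τ j, σ j⟫_ℂ) := by
    rw [← LinearMap.comp_assoc, hρ, ← Module.End.mul_eq_comp (Lμ ∘ₗ Lν), Finset.mul_sum, map_sum]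
    refine Finset.sum_congr rfl fun j _ => ?_
    rw [Module.End.mul_eq_comp, LinearMap.comp_smul, comp_ketbra, map_smul, trace_ketbra, LinearMap.comp_apply, h1,
      map_smul, h2]
    simp only [inner_smul_right, inner_sum, hon', smul_eq_mul]
    simp
    ring_nf
    simp
  rw [h3, Complex.re_sum, Finset.mul_sum]
  refine Finset.sum_congr rfl fun j _ => ?_
  rw [Complex.re_ofReal_mul]
  simp
  ring
end

section
/- Let A and M be n×n Hermitian complex matrices, K an m×m Hermitian complex matrix, and N, B, D, X complex matrices of sizes m×n, m×n, m×n, n×n respectively, such that i·X = M·A + N†·B, 2·D = N·A + K·B, and X is Hermitian (X† = X). Then (1/2)(A·X + X·A) = i·B†·D − i·D†·B. -/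
open Matrix

/-- Block-matrix elimination of the SLD blocks: from `iX = MA + N†B`, `2D = NA + KB`
with `A, M, K` Hermitian and `X` Hermitian, one gets `(1/2)(AX + XA) = iB†D - iD†B`. -/
theorem stmt16 {n m : ℕ}
    (A M X : Matrix (Fin n) (Fin n) ℂ) (K : Matrix (Fin m) (Fin m) ℂ)
    (N B D : Matrix (Fin m) (Fin n) ℂ)
    (hA : A.IsHermitian) (hM : M.IsHermitian) (hK : K.IsHermitian)
    (hX : X.IsHermitian)
    (h1 : Complex.I • X = M * A + Nᴴ * B)
    (h2 : (2 : ℂ) • D = N * A + K * B) :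
    (1 / 2 : ℂ) • (A * X + X * A) = Complex.I • (Bᴴ * D) - Complex.I • (Dᴴ * B) := by
  have h1' : -(Complex.I • X) = A * M + Bᴴ * N := by
    have h := congrArg conjTranspose h1
    simpa [conjTranspose_smul, hA.eq, hM.eq, hX.eq] using h
  have h2' : (2 : ℂ) • Dᴴ = A * Nᴴ + Bᴴ * K := by
    have h := congrArg conjTranspose h2
    simpa [conjTranspose_smul, hA.eq, hK.eq] using h
  have e1 : Complex.I • (A * X) = A * M * A + A * Nᴴ * B := by
    rw [← Matrix.mul_smul, h1, Matrix.mul_add, Matrix.mul_assoc, Matrix.mul_assoc]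
  have e2 : -(Complex.I • (X * A)) = A * M * A + Bᴴ * N * A := by
    rw [← Matrix.smul_mul, ← Matrix.neg_mul, h1', Matrix.add_mul]
  have e3 : (2 : ℂ) • (Bᴴ * D) = Bᴴ * N * A + Bᴴ * K * B := by
    rw [← Matrix.mul_smul, h2, Matrix.mul_add, Matrix.mul_assoc, Matrix.mul_assoc]
  have e4 : (2 : ℂ) • (Dᴴ * B) = A * Nᴴ * B + Bᴴ * K * B := by
    rw [← Matrix.smul_mul, h2', Matrix.add_mul]
  ext i j
  have f1 := congrFun (congrFun e1 i) j
  have f2 := congrFun (congrFun e2 i) j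
  have f3 := congrFun (congrFun e3 i) j
  have f4 := congrFun (congrFun e4 i) j
  simp only [Matrix.add_apply, Matrix.sub_apply, Matrix.neg_apply, Matrix.smul_apply,
    smul_eq_mul] at f1 f2 f3 f4 ⊢
  have hI := Complex.I_mul_I
  linear_combination (-Complex.I / 2) * (f1 - f2 + f3 - f4)
    + (1 / 2) * ((A * X) i j + (X * A) i j) * hI
end
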